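/- arXiv:1407.8203 — 3 statements merged into one kernel-verified Lean document; each statement's English description precedes it below -/
import Mathlib

section
/- Let ι be a finite index type, d a natural number, s : Matrix ι ι ℝ a matrix with all entries nonnegative, and k : ι → ℝ a vector with all entries nonnegative. Suppose S : ℕ → ι → ℝ satisfies the componentwise generalized entropy recursion S(n+1) ≤ s.mulVec (S n) + 2^{n(d−1)} • k (inequality in each component) for all n ∈ ℕ. Then for every n ∈ ℕ, componentwise, S(n) ≤ (s^n).mulVec (S 0) + ∑_{m=0}^{n−1} 2^{(n−1−m)(d−1)} • ((s^m).mulVec k). -/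
/-- Generalized s-source entropy recursion: componentwise solution of the
matrix recursion `S (n+1) ≤ s.mulVec (S n) + 2^(n*(d-1)) • k`. -/
theorem generalized_s_source_entropy_recursion
    {ι : Type*} [Fintype ι] [DecidableEq ι] (d : ℕ)
    (s : Matrix ι ι ℝ) (hs : ∀ i j, 0 ≤ s i j)
    (k : ι → ℝ) (hkpos : ∀ i, 0 ≤ k i)
    (S : ℕ → ι → ℝ)
    (hrec : ∀ n : ℕ, S (n + 1) ≤ s.mulVec (S n) + ((2 : ℝ) ^ (n * (d - 1))) • k) :
    ∀ n : ℕ,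
      S n ≤ (s ^ n).mulVec (S 0)
        + ∑ m ∈ Finset.range n,
            ((2 : ℝ) ^ ((n - 1 - m) * (d - 1))) • ((s ^ m).mulVec k) := by
  intro n
  induction n with
  | zero => simp
  | succ n ih =>
    have hmono : s.mulVec (S n) ≤ s.mulVec ((s ^ n).mulVec (S 0)
        + ∑ m ∈ Finset.range n,
            ((2 : ℝ) ^ ((n - 1 - m) * (d - 1))) • ((s ^ m).mulVec k)) :=
      fun i => Finset.sum_le_sum fun j _ => mul_le_mul_of_nonneg_left (ih j) (hs i j)
    refine (hrec n).trans ((add_le_add_left hmono _).trans_eq ?_)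
    have hexp (m : ℕ) : n - 1 - m = n - (m + 1) := by omega
    simp only [Finset.sum_range_succ', hexp, Matrix.mulVec_add, Matrix.mulVec_sum,
      Matrix.mulVec_smul, Matrix.mulVec_mulVec, ← pow_succ', pow_zero, Matrix.one_mulVec,
      Nat.add_sub_cancel, Nat.sub_zero, add_assoc]
end

section
/- Let n be a finite type and let P, ρ, σ : Matrix n n ℂ, where P is Hermitian and idempotent (P * P = P), and ρ and σ are positive semidefinite. If (P * ρ).trace = ρ.trace (ρ is fully supported on the range of P) and (P * σ).trace = 0 (σ is orthogonal to the range of P), then ρ * σ = 0. -/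
open scoped ComplexOrder

open scoped MatrixOrder Matrix.Norms.L2Operator in
theorem Matrix.PosSemidef.mul_eq_zero_of_trace_mul_eq_zero
    {𝕜 n : Type*} [RCLike 𝕜] [Fintype n] {A B : Matrix n n 𝕜}
    (hA : A.PosSemidef) (hB : B.PosSemidef) (h : (A * B).trace = 0) : A * B = 0 := by
  classical
  obtain ⟨C, rfl⟩ := CStarAlgebra.nonneg_iff_eq_star_mul_self.mp hA.nonneg
  obtain ⟨D, rfl⟩ := CStarAlgebra.nonneg_iff_eq_star_mul_self.mp hB.nonneg
  have hCD : C * D.conjTranspose = 0 := by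
    rw [← Matrix.trace_mul_conjTranspose_self_eq_zero_iff, ← h, Matrix.conjTranspose_mul,
      Matrix.conjTranspose_conjTranspose, ← Matrix.mul_assoc, Matrix.trace_mul_comm]
    simp only [Matrix.star_eq_conjTranspose, Matrix.mul_assoc]
  rw [Matrix.star_eq_conjTranspose, Matrix.star_eq_conjTranspose, Matrix.mul_assoc,
    ← Matrix.mul_assoc C, hCD, Matrix.zero_mul, Matrix.mul_zero]

theorem Matrix.IsHermitian.posSemidef_of_mul_self
    {𝕜 n : Type*} [RCLike 𝕜] [Fintype n] {P : Matrix n n 𝕜}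
    (hP : P.IsHermitian) (hP2 : P * P = P) : P.PosSemidef := by
  simpa only [hP.eq, hP2] using Matrix.posSemidef_conjTranspose_mul_self P

/-- A PSD matrix fully supported on the range of a Hermitian projector `P`
annihilates any PSD matrix orthogonal to the range of `P`. -/
theorem psd_orthogonal_support_mul_eq_zero
    {n : Type*} [Fintype n] [DecidableEq n]
    (P ρ σ : Matrix n n ℂ)
    (hP : P.IsHermitian) (hP2 : P * P = P)
    (hρ : ρ.PosSemidef) (hσ : σ.PosSemidef)
    (hρsupp : (P * ρ).trace = ρ.trace)
    (hσorth : (P * σ).trace = 0) :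
    ρ * σ = 0 := by
  have hPσ : P * σ = 0 :=
    (hP.posSemidef_of_mul_self hP2).mul_eq_zero_of_trace_mul_eq_zero hσ hσorth
  have hQ : (1 - P).PosSemidef :=
    (Matrix.isHermitian_one.sub hP).posSemidef_of_mul_self (IsIdempotentElem.one_sub hP2)
  have hρP : ρ * (1 - P) = 0 := by
    refine hρ.mul_eq_zero_of_trace_mul_eq_zero hQ ?_
    rw [Matrix.trace_mul_comm, Matrix.sub_mul, Matrix.one_mul, Matrix.trace_sub, hρsupp, sub_self]
  calc ρ * σ = ρ * (1 - P) * σ + ρ * (P * σ) := by noncomm_ring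
    _ = 0 := by rw [hρP, hPσ, Matrix.zero_mul, Matrix.mul_zero, add_zero]
end

section
/- Let D ≥ 2 be a natural number, let n be a real number with 0 < n < 1, and let T be a real number with 0 < T < 1. The order-n Rényi entropy of the probability distribution σ with one weight 1 − T and D − 1 equal weights T/(D−1), namely S_n(σ) = (1/(1−n))·log((1−T)^n + (D−1)·(T/(D−1))^n), satisfies the lower bound S_n(σ) ≥ log(D−1) + (n/(1−n))·log T. Consequently, to make S_n(σ) of order ε one must take T at most of order ε^{... }·(D−1)^{−(1−n)/n}, exponentially small in the dimension for n < 1, so the Rényi entropies with n < 1 are effectively discontinuous in trace distance. -/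
/-- Lower bound on the order-`n` Rényi entropy (`0 < n < 1`) of the
distribution `(1-T, T/(D-1), …, T/(D-1))`, showing effective discontinuity of
Rényi entropies with `n < 1`. -/
theorem renyi_entropy_lower_bound (D : ℕ) (hD : 2 ≤ D)
    (n : ℝ) (hn0 : 0 < n) (hn1 : n < 1)
    (T : ℝ) (hT0 : 0 < T) (hT1 : T < 1) :
    Real.log ((D : ℝ) - 1) + (n / (1 - n)) * Real.log T
      ≤ (1 / (1 - n))
          * Real.log ((1 - T) ^ n + ((D : ℝ) - 1) * (T / ((D : ℝ) - 1)) ^ n) := by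
  have hd : (0 : ℝ) < (D : ℝ) - 1 := by
    have : (2 : ℝ) ≤ D := by exact_mod_cast hD
    linarith
  have h1n : 0 < 1 - n := sub_pos.mpr hn1
  have hq : 0 < T / ((D : ℝ) - 1) := div_pos hT0 hd
  have hpow : 0 < (T / ((D : ℝ) - 1)) ^ n := Real.rpow_pos_of_pos hq n
  have hlog : Real.log (((D : ℝ) - 1) * (T / ((D : ℝ) - 1)) ^ n)
      = (1 - n) * Real.log ((D : ℝ) - 1) + n * Real.log T := by
    rw [Real.log_mul hd.ne' hpow.ne', Real.log_rpow hq, Real.log_div hT0.ne' hd.ne']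
    ring
  calc Real.log ((D : ℝ) - 1) + (n / (1 - n)) * Real.log T
      = (1 / (1 - n)) * Real.log (((D : ℝ) - 1) * (T / ((D : ℝ) - 1)) ^ n) := by
        rw [hlog]
        field_simp
    _ ≤ (1 / (1 - n))
          * Real.log ((1 - T) ^ n + ((D : ℝ) - 1) * (T / ((D : ℝ) - 1)) ^ n) := by
        refine mul_le_mul_of_nonneg_left ?_ (one_div_pos.mpr h1n).le
        refine Real.log_le_log (mul_pos hd hpow) (le_add_of_nonneg_left ?_)
        exact Real.rpow_nonneg (sub_nonneg.mpr hT1.le) n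
end
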